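/- arXiv:2407.05012 — 2 statements merged into one kernel-verified Lean document; each statement's English description precedes it below -/
import Mathlib

section
/- There exists a constant C > 0 such that for every α ∈ ℝ, every j ∈ ℤ, every p ∈ [1,∞], and every Schwartz function f : ℝ → ℂ, both estimates hold: ‖𝓕⁻¹[ξ ↦ λ₊(α,2πξ)·φ_j(ξ)·(𝓕f)(ξ)]‖_{L^p(ℝ)} ≤ C·|λ₊(α,2^j)|·‖Δ_j f‖_{L^p(ℝ)} and ‖𝓕⁻¹[ξ ↦ λ₋(α,2πξ)·φ_j(ξ)·(𝓕f)(ξ)]‖_{L^p(ℝ)} ≤ C·|λ₋(α,2^j)|·‖Δ_j f‖_{L^p(ℝ)}, with C independent of α, j, p and f. -/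
open MeasureTheory Real Complex
open scoped FourierTransform ENNReal SchwartzMap

noncomputable section

/-- `λ₊(α,ξ) = (α + √(α² + 4ξ²))/2`. -/
def lamP (α ξ : ℝ) : ℝ := (α + Real.sqrt (α ^ 2 + 4 * ξ ^ 2)) / 2

/-- `λ₋(α,ξ) = (α − √(α² + 4ξ²))/2`. -/
def lamM (α ξ : ℝ) : ℝ := (α - Real.sqrt (α ^ 2 + 4 * ξ ^ 2)) / 2


open Filter Topology Convolution

section LamP

theorem lamP_one_pos (a : ℝ) : 0 < lamP a 1 := by
  have h : |a| < √(a ^ 2 + 4) := Real.lt_sqrt_of_sq_lt (by rw [sq_abs]; linarith)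
  unfold lamP
  rw [one_pow, mul_one]
  linarith [neg_abs_le a]

theorem lamP_mul (r a ξ : ℝ) (hr : 0 ≤ r) : lamP (r * a) (r * ξ) = r * lamP a ξ := by
  unfold lamP
  rw [show (r * a) ^ 2 + 4 * (r * ξ) ^ 2 = r ^ 2 * (a ^ 2 + 4 * ξ ^ 2) by ring,
    Real.sqrt_mul (sq_nonneg r), Real.sqrt_sq hr]
  ring

theorem lamM_eq_neg_lamP_neg (a ξ : ℝ) : lamM a ξ = -lamP (-a) ξ := by
  unfold lamM lamP
  rw [neg_sq]
  ring

theorem inv_sqrt_le_lamP_one (a : ℝ) : (√(a ^ 2 + 4))⁻¹ ≤ lamP a 1 := by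
  have hs : 0 < √(a ^ 2 + 4) := Real.sqrt_pos.2 (by positivity)
  have hsq : √(a ^ 2 + 4) ^ 2 = a ^ 2 + 4 := Real.sq_sqrt (by positivity)
  unfold lamP
  rw [one_pow, mul_one, inv_le_iff_one_le_mul₀ hs]
  nlinarith [sq_nonneg (√(a ^ 2 + 4) + a)]

theorem abs_lamP_le (a ξ : ℝ) (hξ : 1 ≤ ξ ^ 2) : |lamP a ξ| ≤ ξ ^ 2 * lamP a 1 := by
  have hS1 : |a| < √(a ^ 2 + 4) := Real.lt_sqrt_of_sq_lt (by rw [sq_abs]; linarith)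
  have hS : √(a ^ 2 + 4) ≤ √(a ^ 2 + 4 * ξ ^ 2) := Real.sqrt_le_sqrt (by linarith)
  have hsq1 : √(a ^ 2 + 4) ^ 2 = a ^ 2 + 4 := Real.sq_sqrt (by positivity)
  have hsq : √(a ^ 2 + 4 * ξ ^ 2) ^ 2 = a ^ 2 + 4 * ξ ^ 2 := Real.sq_sqrt (by positivity)
  have h1 := neg_abs_le a
  have h2 := le_abs_self a
  unfold lamP
  rw [abs_of_nonneg (by linarith), one_pow, mul_one]
  set s := √(a ^ 2 + 4)
  set S := √(a ^ 2 + 4 * ξ ^ 2)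
  have hd : 0 < s - a := by linarith
  have e1 : (S + a) * (S - a) = ξ ^ 2 * ((s + a) * (s - a)) := by linear_combination hsq - ξ ^ 2 * hsq1
  have e2 : (S + a) * (s - a) ≤ (S + a) * (S - a) :=
    mul_le_mul_of_nonneg_left (by linarith) (by linarith)
  have : S + a ≤ ξ ^ 2 * (s + a) := by
    rw [e1, ← mul_assoc] at e2
    exact le_of_mul_le_mul_right e2 hd
  linarith

theorem hasDerivAt_sqrt_sq_add (a : ℝ) {η : ℝ} (hη : η ≠ 0) :
    HasDerivAt (fun y : ℝ => √(a ^ 2 + 4 * (2 * π * y) ^ 2))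
      (16 * π ^ 2 * η / √(a ^ 2 + 4 * (2 * π * η) ^ 2)) η := by
  have hpos : 0 < a ^ 2 + 4 * (2 * π * η) ^ 2 := by positivity
  have h : HasDerivAt (fun y : ℝ => a ^ 2 + 4 * (2 * π * y) ^ 2) (32 * π ^ 2 * η) η := by
    have h0 := ((((hasDerivAt_id η).const_mul (2 * π)).pow 2).const_mul 4).const_add (a ^ 2)
    refine h0.congr_deriv ?_
    simp
    ring
  refine (h.sqrt hpos.ne').congr_deriv ?_
  have := (Real.sqrt_pos.2 hpos).ne'
  field_simp
  ring

theorem hasDerivAt_lamP (a : ℝ) {η : ℝ} (hη : η ≠ 0) :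
    HasDerivAt (fun y : ℝ => lamP a (2 * π * y))
      (8 * π ^ 2 * η / √(a ^ 2 + 4 * (2 * π * η) ^ 2)) η := by
  refine (((hasDerivAt_sqrt_sq_add a hη).const_add a).div_const 2).congr_deriv ?_
  ring

theorem hasDerivAt_deriv_lamP (a : ℝ) {η : ℝ} (hη : η ≠ 0) :
    HasDerivAt (fun y : ℝ => 8 * π ^ 2 * y / √(a ^ 2 + 4 * (2 * π * y) ^ 2))
      (8 * π ^ 2 * a ^ 2 / √(a ^ 2 + 4 * (2 * π * η) ^ 2) ^ 3) η := by
  have hpos : 0 < a ^ 2 + 4 * (2 * π * η) ^ 2 := by positivity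
  have hs := (Real.sqrt_pos.2 hpos).ne'
  have hsq := Real.sq_sqrt hpos.le
  refine (((hasDerivAt_id η).const_mul (8 * π ^ 2)).div (hasDerivAt_sqrt_sq_add a hη) hs).congr_deriv ?_
  simp only [id, mul_one]
  rw [div_eq_div_iff (pow_ne_zero 2 hs) (pow_ne_zero 3 hs)]
  set S := √(a ^ 2 + 4 * (2 * π * η) ^ 2)
  field_simp
  linear_combination hsq

theorem contDiffAt_lamP (a : ℝ) {η : ℝ} (hη : η ≠ 0) :
    ContDiffAt ℝ (⊤ : ℕ∞) (fun y : ℝ => lamP a (2 * π * y)) η := by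
  have hpos : 0 < a ^ 2 + 4 * (2 * π * η) ^ 2 := by positivity
  unfold lamP
  have h : ContDiffAt ℝ (⊤ : ℕ∞) (fun y : ℝ => a ^ 2 + 4 * (2 * π * y) ^ 2) η := by fun_prop
  exact (contDiffAt_const.add (h.sqrt hpos.ne')).div_const 2

/-- Size of the symbol and of its first two derivatives on the annulus `1/4 ≤ |η| ≤ 4`. -/
theorem lamP_symbol_bounds (a : ℝ) {η : ℝ} (h1 : 1 / 4 ≤ |η|) (h2 : |η| ≤ 4) :
    |lamP a (2 * π * η)| ≤ 64 * π ^ 2 * lamP a 1 ∧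
    |8 * π ^ 2 * η / √(a ^ 2 + 4 * (2 * π * η) ^ 2)| ≤ 64 * π ^ 2 * lamP a 1 ∧
    |8 * π ^ 2 * a ^ 2 / √(a ^ 2 + 4 * (2 * π * η) ^ 2) ^ 3| ≤ 64 * π ^ 2 * lamP a 1 := by
  have hL := lamP_one_pos a
  have hπ := Real.two_le_pi
  have hη1 : 1 / 16 ≤ η ^ 2 := by rw [← sq_abs]; nlinarith
  have hη2 : η ^ 2 ≤ 16 := by rw [← sq_abs]; nlinarith [abs_nonneg η]
  have hξ : 1 ≤ (2 * π * η) ^ 2 := by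
    have : 4 ≤ π ^ 2 := by nlinarith
    nlinarith
  have hs : 0 < √(a ^ 2 + 4) := Real.sqrt_pos.2 (by positivity)
  have hsS : √(a ^ 2 + 4) ≤ √(a ^ 2 + 4 * (2 * π * η) ^ 2) := Real.sqrt_le_sqrt (by linarith)
  have hsq := Real.sq_sqrt (show 0 ≤ a ^ 2 + 4 * (2 * π * η) ^ 2 by positivity)
  have hfirst := abs_lamP_le a _ hξ
  have hinv := inv_sqrt_le_lamP_one a
  set S := √(a ^ 2 + 4 * (2 * π * η) ^ 2)
  have hSpos : 0 < S := hs.trans_le hsS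
  have hSinv : S⁻¹ ≤ lamP a 1 := (inv_anti₀ hs hsS).trans hinv
  refine ⟨hfirst.trans ?_, ?_, ?_⟩
  · gcongr
    nlinarith [sq_nonneg π]
  · rw [div_eq_mul_inv, abs_mul, abs_mul, abs_of_pos (inv_pos.2 hSpos),
      abs_of_nonneg (by positivity : 0 ≤ 8 * π ^ 2)]
    calc 8 * π ^ 2 * |η| * S⁻¹ ≤ 8 * π ^ 2 * 4 * lamP a 1 := by gcongr
      _ ≤ 64 * π ^ 2 * lamP a 1 := by nlinarith [mul_nonneg (sq_nonneg π) hL.le]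
  · have hq : a ^ 2 / S ^ 2 ≤ 1 := div_le_one_of_le₀ (by rw [hsq]; nlinarith) (by positivity)
    rw [abs_of_nonneg (by positivity)]
    calc 8 * π ^ 2 * a ^ 2 / S ^ 3 = 8 * π ^ 2 * (a ^ 2 / S ^ 2) * S⁻¹ := by
          field_simp
      _ ≤ 8 * π ^ 2 * 1 * lamP a 1 := by gcongr
      _ ≤ 64 * π ^ 2 * lamP a 1 := by nlinarith [mul_nonneg (sq_nonneg π) hL.le]

end LamP

section Cutoff

theorem exists_annulus_cutoff : ∃ χ : ℝ → ℝ, ContDiff ℝ (⊤ : ℕ∞) χ ∧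
    (∀ η, 1 / 2 ≤ |η| → |η| ≤ 2 → χ η = 1) ∧ (∀ η, |η| ≤ 1 / 4 → χ η = 0) ∧
    (∀ η, 4 ≤ |η| → χ η = 0) := by
  let b : ContDiffBump (5 / 4 : ℝ) := ⟨3 / 4, 1, by norm_num, by norm_num⟩
  have h1 : ∀ η : ℝ, 1 / 2 ≤ η → η ≤ 2 → b η = 1 := fun η h h' =>
    b.one_of_mem_closedBall (by
      rw [Metric.mem_closedBall, Real.dist_eq, abs_le]
      constructor <;> simp only [b] <;> linarith)
  have h0 : ∀ η : ℝ, η ≤ 1 / 4 → b η = 0 := fun η h =>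
    b.zero_of_le_dist (by
      rw [Real.dist_eq, le_abs]
      right
      simp only [b]
      linarith)
  have h0' : ∀ η : ℝ, 4 ≤ η → b η = 0 := fun η h =>
    b.zero_of_le_dist (by
      rw [Real.dist_eq, le_abs]
      left
      simp only [b]
      linarith)
  refine ⟨fun η => b η + b (-η), b.contDiff.add (b.contDiff.comp contDiff_neg), ?_, ?_, ?_⟩
  · intro η h h'
    rcases le_total 0 η with hη | hη
    · rw [abs_of_nonneg hη] at h h'
      simp [h1 η h h', h0 (-η) (by linarith)]
    · rw [abs_of_nonpos hη] at h h'
      simp [h1 (-η) h h', h0 η (by linarith)]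
  · intro η h
    rw [abs_le] at h
    simp [h0 η (by linarith), h0 (-η) (by linarith)]
  · intro η h
    rw [le_abs] at h
    rcases h with h | h
    · simp [h0' η h, h0 (-η) (by linarith)]
    · simp [h0' (-η) h, h0 η (by linarith)]

end Cutoff

section Young

/-- Young's convolution inequality with one factor in `L¹`. -/
theorem eLpNorm_convolution_mul_le {k g : ℝ → ℂ} (hk : Measurable k) (hg : Measurable g)
    {p : ℝ≥0∞} (hp : 1 ≤ p) :
    eLpNorm (k ⋆[ContinuousLinearMap.mul ℂ ℂ] g) p volume ≤
      (∫⁻ t, ‖k t‖ₑ) * eLpNorm g p volume := by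
  have hpt : ∀ x, ‖(k ⋆[ContinuousLinearMap.mul ℂ ℂ] g) x‖ₑ ≤ ∫⁻ t, ‖k t‖ₑ * ‖g (x - t)‖ₑ := by
    intro x
    refine (enorm_integral_le_lintegral_enorm _).trans_eq ?_
    simp [enorm_mul]
  rcases eq_or_ne p ∞ with rfl | hptop
  · refine eLpNormEssSup_le_of_ae_enorm_bound (.of_forall fun x => (hpt x).trans ?_)
    rw [← lintegral_mul_const _ hk.enorm]
    refine lintegral_mono_ae ?_
    have hq := (Measure.measurePreserving_sub_left (volume : Measure ℝ) x).quasiMeasurePreserving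
    filter_upwards [hq.ae (ae_le_eLpNormEssSup (f := g) (μ := volume))] with t ht
    gcongr
    exact ht
  have hp0 : p ≠ 0 := (zero_lt_one.trans_le hp).ne'
  set q := p.toReal with hq
  have hq1 : 1 ≤ q := by
    rw [hq, ← ENNReal.toReal_one]
    exact ENNReal.toReal_mono hptop hp
  have hq0 : 0 < q := by linarith
  set N := ∫⁻ t, ‖k t‖ₑ with hN
  set ν := (volume : Measure ℝ).withDensity (fun t => ‖k t‖ₑ) with hν
  have hνuniv : ν Set.univ = N := by simp [hν, hN]
  have holder : ∀ x, (∫⁻ t, ‖k t‖ₑ * ‖g (x - t)‖ₑ) ^ q ≤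
      N ^ (q - 1) * ∫⁻ t, ‖k t‖ₑ * ‖g (x - t)‖ₑ ^ q := by
    intro x
    have hgx : Measurable fun t => g (x - t) := hg.comp (measurable_const.sub measurable_id)
    have h := eLpNorm_le_eLpNorm_mul_rpow_measure_univ (μ := ν) (f := fun t => g (x - t)) hp
      hgx.aestronglyMeasurable
    rw [eLpNorm_one_eq_lintegral_enorm, eLpNorm_eq_lintegral_rpow_enorm_toReal hp0 hptop, hνuniv,
      lintegral_withDensity_eq_lintegral_mul _ hk.enorm hgx.enorm,
      lintegral_withDensity_eq_lintegral_mul _ hk.enorm (hgx.enorm.pow_const _)] at h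
    refine (ENNReal.rpow_le_rpow h hq0.le).trans_eq ?_
    rw [ENNReal.mul_rpow_of_nonneg _ _ hq0.le, ← ENNReal.rpow_mul, ← ENNReal.rpow_mul,
      ← hq, one_div_mul_cancel hq0.ne', ENNReal.rpow_one, mul_comm]
    congr 2
    rw [ENNReal.toReal_one]
    field_simp
  rw [eLpNorm_eq_lintegral_rpow_enorm_toReal hp0 hptop,
    eLpNorm_eq_lintegral_rpow_enorm_toReal hp0 hptop, ← hq]
  have hmain : ∫⁻ x, ‖(k ⋆[ContinuousLinearMap.mul ℂ ℂ] g) x‖ₑ ^ q ≤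
      N ^ q * ∫⁻ x, ‖g x‖ₑ ^ q := by
    calc ∫⁻ x, ‖(k ⋆[ContinuousLinearMap.mul ℂ ℂ] g) x‖ₑ ^ q
        ≤ ∫⁻ x, N ^ (q - 1) * ∫⁻ t, ‖k t‖ₑ * ‖g (x - t)‖ₑ ^ q :=
          lintegral_mono fun x => (ENNReal.rpow_le_rpow (hpt x) hq0.le).trans (holder x)
      _ = N ^ (q - 1) * ∫⁻ x, ∫⁻ t, ‖k t‖ₑ * ‖g (x - t)‖ₑ ^ q := by
          rw [lintegral_const_mul]
          fun_prop
      _ = N ^ (q - 1) * ∫⁻ t, ∫⁻ x, ‖k t‖ₑ * ‖g (x - t)‖ₑ ^ q := by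
          rw [lintegral_lintegral_swap]
          fun_prop
      _ = N ^ (q - 1) * ∫⁻ t, ‖k t‖ₑ * ∫⁻ x, ‖g x‖ₑ ^ q := by
          congr 1
          refine lintegral_congr fun t => ?_
          rw [lintegral_const_mul _ (by fun_prop),
            lintegral_sub_right_eq_self (fun x => ‖g x‖ₑ ^ q) t]
      _ = N ^ q * ∫⁻ x, ‖g x‖ₑ ^ q := by
          rw [lintegral_mul_const _ hk.enorm, ← mul_assoc, ← hN]
          congr 1
          nth_rewrite 2 [← ENNReal.rpow_one N]
          rw [← ENNReal.rpow_add_of_nonneg _ _ (by linarith) zero_le_one, sub_add_cancel]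
  refine (ENNReal.rpow_le_rpow hmain (by positivity)).trans_eq ?_
  rw [ENNReal.mul_rpow_of_nonneg _ _ (by positivity), ← ENNReal.rpow_mul,
    mul_one_div_cancel hq0.ne', ENNReal.rpow_one]

end Young

section Kernel

theorem integral_norm_le_of_bound_of_support {F : ℝ → ℂ} {A : ℝ}
    (hF0 : ∀ η, 4 < |η| → F η = 0) (hA : ∀ η, ‖F η‖ ≤ A) : ∫ η, ‖F η‖ ≤ 8 * A := by
  have hsupp : ∀ η, η ∉ Set.Icc (-4 : ℝ) 4 → ‖F η‖ = 0 := fun η hη => by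
    rw [hF0 η (by rw [Set.mem_Icc, ← abs_le] at hη; exact not_le.1 hη), norm_zero]
  rw [← setIntegral_eq_integral_of_forall_compl_eq_zero hsupp]
  have h := norm_setIntegral_le_of_norm_le_const (μ := volume) (s := Set.Icc (-4 : ℝ) 4)
    (f := fun η => ‖F η‖) (C := A) (by simp) (fun η _ => by simpa using hA η)
  refine (le_abs_self _).trans (h.trans_eq ?_)
  rw [measureReal_def, Real.volume_Icc, ENNReal.toReal_ofReal (by norm_num)]
  ring

/-- A smooth function supported in `[-4, 4]` has an inverse Fourier transform whose `L¹` norm is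
controlled by the sup norms of the function and of its second derivative. -/
theorem lintegral_enorm_fourierInv_le {M : ℝ → ℂ} {A : ℝ} (hM : ContDiff ℝ (⊤ : ℕ∞) M)
    (hM0 : ∀ η, 4 ≤ |η| → M η = 0) (hA : ∀ η, ‖M η‖ ≤ A)
    (hA2 : ∀ η, ‖iteratedDeriv 2 M η‖ ≤ A) :
    ∫⁻ x, ‖𝓕⁻ M x‖ₑ ≤ ENNReal.ofReal (16 * π * A) := by
  have hcomp : HasCompactSupport M := by
    refine HasCompactSupport.intro (isCompact_Icc (a := (-4 : ℝ)) (b := 4)) fun η hη => hM0 η ?_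
    rw [Set.mem_Icc, ← abs_le] at hη
    exact (not_le.1 hη).le
  have hM2supp : ∀ η, 4 < |η| → iteratedDeriv 2 M η = 0 := by
    intro η hη
    have hev : M =ᶠ[𝓝 η] fun _ => 0 := by
      filter_upwards [(isOpen_lt continuous_const continuous_abs).mem_nhds hη] with y hy
      exact hM0 y (le_of_lt hy)
    rw [hev.iteratedDeriv_eq 2]
    simp
  have hint : ∀ n : ℕ, n ≤ ((2 : ℕ) : ℕ∞) → Integrable (iteratedDeriv n M) := by
    intro n _hn
    refine Continuous.integrable_of_hasCompactSupport
      (hM.continuous_iteratedDeriv n (mod_cast le_top)) ?_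
    rw [iteratedDeriv_eq_iterate]
    clear _hn
    induction n with
    | zero => simpa using hcomp
    | succ n ih =>
      rw [Function.iterate_succ_apply']
      exact ih.deriv
  have hfour : ∀ (F : ℝ → ℂ) (y : ℝ), ‖𝓕 F y‖ ≤ ∫ η, ‖F η‖ := fun F y =>
    VectorFourier.norm_fourierIntegral_le_integral_norm _ _ _ _ _
  have hdecay : ∀ x, ‖𝓕⁻ M x‖ ≤ 16 * A * (1 + x ^ 2)⁻¹ := by
    intro x
    rw [fourierInv_eq_fourier_neg, ← div_eq_mul_inv, le_div_iff₀ (by positivity)]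
    have h0 : ‖𝓕 M (-x)‖ ≤ 8 * A :=
      (hfour M (-x)).trans (integral_norm_le_of_bound_of_support (fun η h => hM0 η h.le) hA)
    have h2 : ‖𝓕 (iteratedDeriv 2 M) (-x)‖ ≤ 8 * A :=
      (hfour _ (-x)).trans (integral_norm_le_of_bound_of_support hM2supp hA2)
    rw [Real.fourier_iteratedDeriv (N := ((2 : ℕ) : ℕ∞)) (hM.of_le (mod_cast le_top)) hint le_rfl]
      at h2
    simp only [norm_smul, norm_pow, norm_mul, Complex.norm_ofNat, Complex.norm_I,
      Complex.norm_real, Real.norm_eq_abs, abs_neg, mul_one, abs_of_pos Real.pi_pos] at h2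
    have h3 : x ^ 2 * ‖𝓕 M (-x)‖ ≤ (2 * π * |x|) ^ 2 * ‖𝓕 M (-x)‖ := by
      refine mul_le_mul_of_nonneg_right ?_ (norm_nonneg _)
      rw [mul_pow, sq_abs]
      have hπ : 1 ≤ (2 * π) ^ 2 := by nlinarith [Real.two_le_pi]
      exact le_mul_of_one_le_left (sq_nonneg x) hπ
    linarith
  have hA0 : 0 ≤ A := (norm_nonneg _).trans (hA 0)
  calc ∫⁻ x, ‖𝓕⁻ M x‖ₑ ≤ ∫⁻ x, ENNReal.ofReal (16 * A * (1 + x ^ 2)⁻¹) := by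
        refine lintegral_mono fun x => ?_
        rw [← ofReal_norm]
        exact ENNReal.ofReal_le_ofReal (hdecay x)
    _ = ENNReal.ofReal (16 * π * A) := by
        rw [← ofReal_integral_eq_lintegral_ofReal (integrable_inv_one_add_sq.const_mul _)
          (.of_forall fun x => by positivity), integral_const_mul, integral_univ_inv_one_add_sq]
        congr 1
        ring

theorem fourierInv_comp_div (M : ℝ → ℂ) {r : ℝ} (hr : 0 < r) (x : ℝ) :
    𝓕⁻ (fun ξ => M (ξ / r)) x = (r : ℂ) * 𝓕⁻ M (r * x) := by
  rw [Real.fourierInv_eq', Real.fourierInv_eq']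
  have h := Measure.integral_comp_div
    (fun v : ℝ => Complex.exp (↑(2 * π * inner ℝ v (r * x)) * I) • M v) r
  rw [abs_of_pos hr, Complex.real_smul] at h
  rw [← h]
  refine integral_congr_ae (.of_forall fun v => ?_)
  have : inner ℝ (v / r) (r * x) = inner ℝ v x := by
    simp only [RCLike.inner_apply, conj_trivial]
    field_simp
  simp only [this]

theorem lintegral_enorm_fourierInv_comp_div (M : ℝ → ℂ) {r : ℝ} (hr : 0 < r) :
    ∫⁻ x, ‖𝓕⁻ (fun ξ => M (ξ / r)) x‖ₑ = ∫⁻ x, ‖𝓕⁻ M x‖ₑ := by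
  have hemb : MeasurableEmbedding (fun x : ℝ => r * x) :=
    (Homeomorph.mulLeft₀ r hr.ne').measurableEmbedding
  have hmap := Real.smul_map_volume_mul_left hr.ne'
  rw [abs_of_pos hr] at hmap
  simp_rw [fourierInv_comp_div M hr, enorm_mul]
  rw [lintegral_const_mul' _ _ enorm_ne_top, ← hemb.lintegral_map (fun x => ‖𝓕⁻ M x‖ₑ)]
  conv_rhs => rw [← hmap, lintegral_smul_measure]
  rw [← ofReal_norm, Complex.norm_real, Real.norm_of_nonneg hr.le, smul_eq_mul]

end Kernel

section Symbol

variable {χ : ℝ → ℝ}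

theorem contDiff_lamP_mul_cutoff (hχ : ContDiff ℝ (⊤ : ℕ∞) χ) (hχ0 : ∀ η, |η| ≤ 1 / 4 → χ η = 0)
    (a : ℝ) : ContDiff ℝ (⊤ : ℕ∞) (fun η => lamP a (2 * π * η) * χ η) := by
  rw [contDiff_iff_contDiffAt]
  intro η
  rcases eq_or_ne η 0 with rfl | hη
  · refine (contDiffAt_const (c := (0 : ℝ))).congr_of_eventuallyEq ?_
    have h0 : |(0 : ℝ)| < 1 / 4 := by norm_num
    filter_upwards [(isOpen_lt continuous_abs continuous_const).mem_nhds h0] with y hy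
    rw [hχ0 y (le_of_lt hy), mul_zero]
  · exact (contDiffAt_lamP a hη).mul hχ.contDiffAt

theorem iteratedDeriv_two_lamP_mul_cutoff (hχ : ContDiff ℝ (⊤ : ℕ∞) χ) (a : ℝ) {η : ℝ}
    (hη : η ≠ 0) :
    iteratedDeriv 2 (fun y => lamP a (2 * π * y) * χ y) η =
      8 * π ^ 2 * a ^ 2 / √(a ^ 2 + 4 * (2 * π * η) ^ 2) ^ 3 * χ η +
      2 * (8 * π ^ 2 * η / √(a ^ 2 + 4 * (2 * π * η) ^ 2) * deriv χ η) +
      lamP a (2 * π * η) * deriv (deriv χ) η := by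
  have hχ1 : ∀ y, HasDerivAt χ (deriv χ y) y := fun y =>
    (hχ.differentiable (by simp) y).hasDerivAt
  have hχ2 : HasDerivAt (deriv χ) (deriv (deriv χ) η) η :=
    (((contDiff_infty_iff_deriv.1 hχ).2).differentiable (by simp) η).hasDerivAt
  rw [iteratedDeriv_succ, iteratedDeriv_one]
  have hev : deriv (fun y => lamP a (2 * π * y) * χ y) =ᶠ[𝓝 η] fun y =>
      8 * π ^ 2 * y / √(a ^ 2 + 4 * (2 * π * y) ^ 2) * χ y + lamP a (2 * π * y) * deriv χ y := by
    filter_upwards [isOpen_ne.mem_nhds hη] with y hy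
    exact ((hasDerivAt_lamP a hy).mul (hχ1 y)).deriv
  rw [hev.deriv_eq]
  refine ((((hasDerivAt_deriv_lamP a hη).mul (hχ1 η)).add
    ((hasDerivAt_lamP a hη).mul hχ2)).deriv).trans ?_
  ring

theorem lamP_mul_cutoff_bounds {B : ℝ} (hχ : ContDiff ℝ (⊤ : ℕ∞) χ)
    (hχ0 : ∀ η, |η| ≤ 1 / 4 → χ η = 0) (hχ4 : ∀ η, 4 ≤ |η| → χ η = 0)
    (hB0 : ∀ η, |χ η| ≤ B) (hB1 : ∀ η, |deriv χ η| ≤ B) (hB2 : ∀ η, |deriv (deriv χ) η| ≤ B)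
    (a η : ℝ) :
    |lamP a (2 * π * η) * χ η| ≤ 256 * π ^ 2 * B * lamP a 1 ∧
    |iteratedDeriv 2 (fun y => lamP a (2 * π * y) * χ y) η| ≤ 256 * π ^ 2 * B * lamP a 1 := by
  have hL := lamP_one_pos a
  have hB : 0 ≤ B := (abs_nonneg _).trans (hB0 0)
  have hrhs : 0 ≤ 256 * π ^ 2 * B * lamP a 1 := by positivity
  have outside : ∀ U : Set ℝ, IsOpen U → η ∈ U → (∀ y ∈ U, χ y = 0) →
      |lamP a (2 * π * η) * χ η| ≤ 256 * π ^ 2 * B * lamP a 1 ∧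
      |iteratedDeriv 2 (fun y => lamP a (2 * π * y) * χ y) η| ≤ 256 * π ^ 2 * B * lamP a 1 := by
    intro U hU hηU h
    have hev : (fun y => lamP a (2 * π * y) * χ y) =ᶠ[𝓝 η] fun _ => 0 := by
      filter_upwards [hU.mem_nhds hηU] with y hy
      rw [h y hy, mul_zero]
    rw [hev.iteratedDeriv_eq 2, h η hηU]
    simpa [iteratedDeriv_const] using hrhs
  rcases lt_or_ge |η| (1 / 4) with h1 | h1
  · exact outside {y | |y| < 1 / 4} (isOpen_lt continuous_abs continuous_const) h1
      fun y hy => hχ0 y (le_of_lt hy)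
  rcases lt_or_ge 4 |η| with h2 | h2
  · exact outside {y | 4 < |y|} (isOpen_lt continuous_const continuous_abs) h2
      fun y hy => hχ4 y (le_of_lt hy)
  have hη : η ≠ 0 := by
    rintro rfl
    norm_num at h1
  obtain ⟨b0, b1, b2⟩ := lamP_symbol_bounds a h1 h2
  have prod_le : ∀ {u v : ℝ}, |u| ≤ 64 * π ^ 2 * lamP a 1 → |v| ≤ B →
      |u * v| ≤ 64 * π ^ 2 * lamP a 1 * B := by
    intro u v hu hv
    rw [abs_mul]
    gcongr
  have hpos : 0 ≤ 64 * π ^ 2 * lamP a 1 * B := by positivity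
  refine ⟨(prod_le b0 (hB0 η)).trans (by linarith), ?_⟩
  rw [iteratedDeriv_two_lamP_mul_cutoff hχ a hη]
  have t2 := abs_le.1 (prod_le b2 (hB0 η))
  have t1 := abs_le.1 (prod_le b1 (hB1 η))
  have t0 := abs_le.1 (prod_le b0 (hB2 η))
  rw [abs_le]
  constructor <;> linarith [t2.1, t2.2, t1.1, t1.2, t0.1, t0.2]

theorem iteratedDeriv_two_ofReal {m : ℝ → ℝ} (hm : ContDiff ℝ (⊤ : ℕ∞) m) (η : ℝ) :
    iteratedDeriv 2 (fun y => (m y : ℂ)) η = ((iteratedDeriv 2 m η : ℝ) : ℂ) := by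
  have h1 : deriv (fun y => (m y : ℂ)) = fun y => ((deriv m y : ℝ) : ℂ) := funext fun y =>
    (hm.differentiable (by simp) y).hasDerivAt.ofReal_comp.deriv
  rw [iteratedDeriv_succ, iteratedDeriv_one, iteratedDeriv_succ, iteratedDeriv_one, h1]
  exact ((contDiff_infty_iff_deriv.1 hm).2.differentiable (by simp) η).hasDerivAt.ofReal_comp.deriv

/-- Uniform `L¹` bound for the kernels of the localized multipliers `λ₊(α, 2πξ) χ(ξ / r)`. -/
theorem exists_lintegral_enorm_fourierInv_lamP_le (hχ : ContDiff ℝ (⊤ : ℕ∞) χ)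
    (hχ0 : ∀ η, |η| ≤ 1 / 4 → χ η = 0) (hχ4 : ∀ η, 4 ≤ |η| → χ η = 0) :
    ∃ C : ℝ, 0 < C ∧ ∀ α r : ℝ, 0 < r →
      ∫⁻ x, ‖𝓕⁻ (fun ξ : ℝ => ((lamP α (2 * π * ξ) * χ (ξ / r) : ℝ) : ℂ)) x‖ₑ ≤
        ENNReal.ofReal (C * |lamP α r|) := by
  have hcomp : HasCompactSupport χ := by
    refine HasCompactSupport.intro (isCompact_Icc (a := (-4 : ℝ)) (b := 4)) fun η hη => hχ4 η ?_
    rw [Set.mem_Icc, ← abs_le] at hη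
    exact (not_le.1 hη).le
  have hd1 := (contDiff_infty_iff_deriv.1 hχ).2
  have hd2 := (contDiff_infty_iff_deriv.1 hd1).2
  obtain ⟨B0, hB0⟩ := hcomp.exists_bound_of_continuous hχ.continuous
  obtain ⟨B1, hB1⟩ := hcomp.deriv.exists_bound_of_continuous hd1.continuous
  obtain ⟨B2, hB2⟩ := hcomp.deriv.deriv.exists_bound_of_continuous hd2.continuous
  set B := |B0| + |B1| + |B2| + 1 with hB
  have hBpos : 0 < B := by positivity
  have n0 := abs_nonneg B0
  have n1 := abs_nonneg B1
  have n2 := abs_nonneg B2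
  refine ⟨16 * π * (256 * π ^ 2 * B), by positivity, fun α r hr => ?_⟩
  set a := α / r
  have hα : α = r * a := by simp only [a]; field_simp
  set m : ℝ → ℝ := fun η => lamP a (2 * π * η) * χ η with hm
  have hmC : ContDiff ℝ (⊤ : ℕ∞) m := contDiff_lamP_mul_cutoff hχ hχ0 a
  have hbd := fun η => lamP_mul_cutoff_bounds (B := B) hχ hχ0 hχ4
    (fun η => (hB0 η).trans (by linarith [le_abs_self B0]))
    (fun η => (hB1 η).trans (by linarith [le_abs_self B1]))
    (fun η => (hB2 η).trans (by linarith [le_abs_self B2])) a η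
  have hker := lintegral_enorm_fourierInv_le (M := fun η => ((r * m η : ℝ) : ℂ))
    (A := r * (256 * π ^ 2 * B * lamP a 1))
    (Complex.ofRealCLM.contDiff.comp (contDiff_const.mul hmC))
    (fun η hη => by simp [hm, hχ4 η hη])
    (fun η => by
      rw [Complex.norm_real, norm_mul, Real.norm_of_nonneg hr.le]
      exact mul_le_mul_of_nonneg_left (hbd η).1 hr.le)
    (fun η => by
      rw [iteratedDeriv_two_ofReal (contDiff_const.mul hmC), Complex.norm_real,
        iteratedDeriv_const_mul_field, norm_mul, Real.norm_of_nonneg hr.le]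
      exact mul_le_mul_of_nonneg_left (hbd η).2 hr.le)
  have hsym : (fun ξ : ℝ => ((lamP α (2 * π * ξ) * χ (ξ / r) : ℝ) : ℂ)) =
      fun ξ => ((r * m (ξ / r) : ℝ) : ℂ) := by
    funext ξ
    simp only [hm]
    rw [← mul_assoc, ← lamP_mul r a _ hr.le, ← hα]
    congr 3
    field_simp
  rw [hsym, lintegral_enorm_fourierInv_comp_div (fun η => ((r * m η : ℝ) : ℂ)) hr]
  refine hker.trans_eq ?_
  have h1 : lamP α r = r * lamP a 1 := by rw [← lamP_mul r a 1 hr.le, ← hα, mul_one]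
  rw [h1, abs_of_pos (mul_pos hr (lamP_one_pos a))]
  congr 1
  ring

end Symbol

section Multiplier

/-- The inverse Fourier transform of a product of smooth compactly supported functions is a
convolution, hence bounded in `L^p` by Young's inequality. -/
theorem eLpNorm_fourierInv_mul_le {M G : ℝ → ℂ} (hM : HasCompactSupport M)
    (hM' : ContDiff ℝ (⊤ : ℕ∞) M) (hG : HasCompactSupport G) (hG' : ContDiff ℝ (⊤ : ℕ∞) G)
    {p : ℝ≥0∞} (hp : 1 ≤ p) :
    eLpNorm (𝓕⁻ (fun ξ => M ξ * G ξ)) p volume ≤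
      (∫⁻ x, ‖𝓕⁻ M x‖ₑ) * eLpNorm (𝓕⁻ G) p volume := by
  let S : 𝓢(ℝ, ℂ) := hM.toSchwartzMap hM'
  let T : 𝓢(ℝ, ℂ) := hG.toSchwartzMap hG'
  have hS : ⇑(𝓕⁻ S : 𝓢(ℝ, ℂ)) = 𝓕⁻ M := SchwartzMap.fourierInv_coe S
  have hT : ⇑(𝓕⁻ T : 𝓢(ℝ, ℂ)) = 𝓕⁻ G := SchwartzMap.fourierInv_coe T
  have key : 𝓕⁻ (fun ξ => M ξ * G ξ) = 𝓕⁻ M ⋆[ContinuousLinearMap.mul ℂ ℂ] 𝓕⁻ G := by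
    have h1 : SchwartzMap.convolution (ContinuousLinearMap.mul ℂ ℂ) (𝓕⁻ S) (𝓕⁻ T) =
        𝓕⁻ (SchwartzMap.pairing (ContinuousLinearMap.mul ℂ ℂ) S T) := by
      simp [SchwartzMap.convolution]
    funext x
    rw [← hS, ← hT, ← SchwartzMap.convolution_apply, h1, SchwartzMap.fourierInv_coe]
    rfl
  rw [key]
  refine eLpNorm_convolution_mul_le ?_ ?_ hp
  · rw [← hS]
    exact (𝓕⁻ S : 𝓢(ℝ, ℂ)).continuous.measurable
  · rw [← hT]
    exact (𝓕⁻ T : 𝓢(ℝ, ℂ)).continuous.measurable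

theorem exists_eLpNorm_lamP_multiplier_le {φ : ℝ → ℝ} (hφ : ContDiff ℝ (⊤ : ℕ∞) φ)
    (hsupp : Function.support φ ⊆ {ξ : ℝ | 1 / 2 ≤ |ξ| ∧ |ξ| ≤ 2}) :
    ∃ C : ℝ, 0 < C ∧ ∀ (α r : ℝ), 0 < r → ∀ p : ℝ≥0∞, 1 ≤ p → ∀ f : 𝓢(ℝ, ℂ),
      eLpNorm (𝓕⁻ (fun ξ : ℝ =>
          (lamP α (2 * π * ξ) : ℂ) * (φ (r⁻¹ * ξ) : ℂ) * 𝓕 (⇑f) ξ)) p volume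
        ≤ ENNReal.ofReal (C * |lamP α r|) *
          eLpNorm (𝓕⁻ (fun ξ : ℝ => (φ (r⁻¹ * ξ) : ℂ) * 𝓕 (⇑f) ξ)) p volume := by
  obtain ⟨χ, hχ, hχ1, hχ0, hχ4⟩ := exists_annulus_cutoff
  obtain ⟨C, hC, hker⟩ := exists_lintegral_enorm_fourierInv_lamP_le hχ hχ0 hχ4
  refine ⟨C, hC, fun α r hr p hp f => ?_⟩
  have compact_of : ∀ F : ℝ → ℂ, (∀ ξ, 4 < |ξ / r| → F ξ = 0) → HasCompactSupport F := by
    intro F hF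
    refine HasCompactSupport.intro (isCompact_Icc (a := -(4 * r)) (b := 4 * r)) fun ξ hξ => hF ξ ?_
    rw [Set.mem_Icc, ← abs_le, not_le] at hξ
    rwa [abs_div, abs_of_pos hr, lt_div_iff₀ hr]
  have hsym : ContDiff ℝ (⊤ : ℕ∞) fun ξ : ℝ => lamP α (2 * π * ξ) * χ (ξ / r) := by
    have h := contDiff_const (c := r) |>.mul
      ((contDiff_lamP_mul_cutoff hχ hχ0 (α / r)).comp (contDiff_id.div_const r))
    have heq : (fun ξ : ℝ => lamP α (2 * π * ξ) * χ (ξ / r)) =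
        fun ξ => r * (lamP (α / r) (2 * π * (ξ / r)) * χ (ξ / r)) := by
      funext ξ
      rw [← mul_assoc, ← lamP_mul r _ _ hr.le]
      congr 2 <;> field_simp
    rw [heq]
    exact h
  have hMC : ContDiff ℝ (⊤ : ℕ∞) fun ξ : ℝ => ((lamP α (2 * π * ξ) * χ (ξ / r) : ℝ) : ℂ) :=
    Complex.ofRealCLM.contDiff.comp hsym
  have hf : ContDiff ℝ (⊤ : ℕ∞) (𝓕 (⇑f)) := by
    rw [← SchwartzMap.fourier_coe]
    exact (𝓕 f).smooth _
  have hGC : ContDiff ℝ (⊤ : ℕ∞) fun ξ : ℝ => (φ (r⁻¹ * ξ) : ℂ) * 𝓕 (⇑f) ξ :=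
    (Complex.ofRealCLM.contDiff.comp (hφ.comp (contDiff_const.mul contDiff_id))).mul hf
  have hφ0 : ∀ ξ, ¬(1 / 2 ≤ |ξ| ∧ |ξ| ≤ 2) → φ ξ = 0 := fun ξ h =>
    Function.notMem_support.1 fun h' => h (hsupp h')
  have h := eLpNorm_fourierInv_mul_le
    (compact_of _ fun ξ hξ => by rw [hχ4 _ hξ.le, mul_zero, Complex.ofReal_zero]) hMC
    (compact_of (fun ξ : ℝ => (φ (r⁻¹ * ξ) : ℂ) * 𝓕 (⇑f) ξ) fun ξ hξ => by
      rw [inv_mul_eq_div, hφ0 _ (fun h => by linarith [h.2]), Complex.ofReal_zero, zero_mul])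
    hGC hp
  have hprod : (fun ξ : ℝ => (lamP α (2 * π * ξ) : ℂ) * (φ (r⁻¹ * ξ) : ℂ) * 𝓕 (⇑f) ξ) =
      fun ξ => ((lamP α (2 * π * ξ) * χ (ξ / r) : ℝ) : ℂ) * ((φ (r⁻¹ * ξ) : ℂ) * 𝓕 (⇑f) ξ) := by
    funext ξ
    rw [inv_mul_eq_div]
    by_cases hξ : 1 / 2 ≤ |ξ / r| ∧ |ξ / r| ≤ 2
    · rw [hχ1 _ hξ.1 hξ.2, mul_one, mul_assoc]
    · simp [hφ0 _ hξ]
  rw [hprod]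
  exact h.trans (mul_le_mul_left (hker α r hr) _)

end Multiplier

/-- frequency-localized bounds for the Fourier multipliers `λ₊(α, 2πξ)`
and `λ₋(α, 2πξ)`:
`‖𝓕⁻¹[λ±(α,2πξ) φ_j 𝓕f]‖_{L^p} ≤ C |λ±(α,2^j)| ‖Δ_j f‖_{L^p}`. -/
theorem statement1 (φ₀ : ℝ → ℝ)
    (hφ_smooth : ContDiff ℝ (⊤ : ℕ∞) φ₀)
    (hφ_range : ∀ ξ : ℝ, 0 ≤ φ₀ ξ ∧ φ₀ ξ ≤ 1)
    (hφ_supp : Function.support φ₀ ⊆ {ξ : ℝ | 1/2 ≤ |ξ| ∧ |ξ| ≤ 2})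
    (hφ_sum : ∀ ξ : ℝ, ξ ≠ 0 → HasSum (fun j : ℤ => φ₀ ((2:ℝ) ^ (-j) * ξ)) 1) :
    ∃ C : ℝ, 0 < C ∧
      ∀ (α : ℝ) (j : ℤ) (p : ℝ≥0∞), 1 ≤ p → ∀ f : 𝓢(ℝ, ℂ),
        eLpNorm (𝓕⁻ (fun ξ : ℝ =>
            (lamP α (2 * π * ξ) : ℂ) * (φ₀ ((2:ℝ) ^ (-j) * ξ) : ℂ) * 𝓕 (⇑f) ξ)) p volume
          ≤ ENNReal.ofReal (C * |lamP α ((2:ℝ) ^ j)|) *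
            eLpNorm (𝓕⁻ (fun ξ : ℝ =>
              (φ₀ ((2:ℝ) ^ (-j) * ξ) : ℂ) * 𝓕 (⇑f) ξ)) p volume
        ∧
        eLpNorm (𝓕⁻ (fun ξ : ℝ =>
            (lamM α (2 * π * ξ) : ℂ) * (φ₀ ((2:ℝ) ^ (-j) * ξ) : ℂ) * 𝓕 (⇑f) ξ)) p volume
          ≤ ENNReal.ofReal (C * |lamM α ((2:ℝ) ^ j)|) *
            eLpNorm (𝓕⁻ (fun ξ : ℝ =>
              (φ₀ ((2:ℝ) ^ (-j) * ξ) : ℂ) * 𝓕 (⇑f) ξ)) p volume := by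
  obtain ⟨C, hC, h⟩ := exists_eLpNorm_lamP_multiplier_le hφ_smooth hφ_supp
  refine ⟨C, hC, fun α j p hp f => ?_⟩
  have hr : (0 : ℝ) < 2 ^ j := by positivity
  rw [zpow_neg]
  refine ⟨h α _ hr p hp f, ?_⟩
  have hneg : (fun ξ : ℝ => (lamM α (2 * π * ξ) : ℂ) * (φ₀ (((2 : ℝ) ^ j)⁻¹ * ξ) : ℂ) * 𝓕 (⇑f) ξ) =
      -fun ξ : ℝ =>
        (lamP (-α) (2 * π * ξ) : ℂ) * (φ₀ (((2 : ℝ) ^ j)⁻¹ * ξ) : ℂ) * 𝓕 (⇑f) ξ := by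
    funext ξ
    simp [lamM_eq_neg_lamP_neg]
  have hfneg : ∀ F : ℝ → ℂ, 𝓕⁻ (-F) = -𝓕⁻ F := by
    intro F
    funext x
    simp [Real.fourierInv_eq', integral_neg]
  rw [hneg, hfneg, eLpNorm_neg, lamM_eq_neg_lamP_neg α, abs_neg]
  exact h (-α) _ hr p hp f
end
end

section
/- There exist constants c, C > 0 such that for every α ∈ ℝ, every T > 0, every j ∈ ℤ, every p ∈ [1,∞], and every Schwartz function f : ℝ → ℂ, both estimates hold: ‖𝓕⁻¹[ξ ↦ e^{−λ₊(α,2πξ)·T}·φ_j(ξ)·(𝓕f)(ξ)]‖_{L^p(ℝ)} ≤ C·e^{−c·λ₊(α,2^j)·T}·‖Δ_j f‖_{L^p(ℝ)} and ‖𝓕⁻¹[ξ ↦ e^{λ₋(α,2πξ)·T}·φ_j(ξ)·(𝓕f)(ξ)]‖_{L^p(ℝ)} ≤ C·e^{c·λ₋(α,2^j)·T}·‖Δ_j f‖_{L^p(ℝ)}, with c, C independent of α, T, j, p and f. -/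
open MeasureTheory Real Complex
open scoped FourierTransform ENNReal SchwartzMap

noncomputable section

theorem lintegral_rpow_le_of_one_le {k : ℝ → ℝ≥0∞} {h : ℝ → ℂ} (hk : Measurable k)
    (hh : Measurable h) {q : ℝ} (hq : 1 ≤ q) :
    (∫⁻ y, k y * ‖h y‖ₑ) ^ q ≤ (∫⁻ y, k y * ‖h y‖ₑ ^ q) * (∫⁻ y, k y) ^ (q - 1) := by
  have hq0 : 0 < q := by linarith
  have h1 := eLpNorm'_le_eLpNorm'_mul_rpow_measure_univ (μ := volume.withDensity k) zero_lt_one hq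
    hh.aestronglyMeasurable
  have h2 := ENNReal.rpow_le_rpow h1 hq0.le
  simp only [eLpNorm', ENNReal.rpow_one, div_one] at h2
  rw [ENNReal.mul_rpow_of_nonneg _ _ hq0.le, ← ENNReal.rpow_mul, ← ENNReal.rpow_mul,
    one_div_mul_cancel hq0.ne', ENNReal.rpow_one, sub_mul, one_div_mul_cancel hq0.ne', one_mul,
    withDensity_apply _ MeasurableSet.univ, setLIntegral_univ,
    lintegral_withDensity_eq_lintegral_mul _ hk (by fun_prop),
    lintegral_withDensity_eq_lintegral_mul _ hk (by fun_prop)] at h2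
  exact h2

/-- Young's convolution inequality `L¹ * Lᵖ ⊆ Lᵖ`, with dilated translations. -/
theorem eLpNorm_integral_mul_comp_sub_le {K h : ℝ → ℂ} (hK : Measurable K) (hh : Measurable h)
    {s : ℝ} (hs : s ≠ 0) {p : ℝ≥0∞} (hp : 1 ≤ p) :
    eLpNorm (fun x ↦ ∫ y, K y * h (x - s * y)) p volume
      ≤ (∫⁻ y, ‖K y‖ₑ) * eLpNorm h p volume := by
  have hpt (x : ℝ) : ‖∫ y, K y * h (x - s * y)‖ₑ ≤ ∫⁻ y, ‖K y‖ₑ * ‖h (x - s * y)‖ₑ := by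
    simpa [enorm_mul] using enorm_integral_le_lintegral_enorm (fun y ↦ K y * h (x - s * y))
  rcases eq_or_ne p ∞ with rfl | hp'
  · rw [eLpNorm_exponent_top, eLpNorm_exponent_top]
    refine essSup_le_of_ae_le _ (Filter.Eventually.of_forall fun x ↦ ?_)
    refine (hpt x).trans ?_
    rw [← lintegral_mul_const _ (by fun_prop)]
    refine lintegral_mono_ae ?_
    have hqm : Measure.QuasiMeasurePreserving (fun y : ℝ ↦ x - s * y) volume volume :=
      (quasiMeasurePreserving_sub_left volume x).comp
        (f := fun y ↦ s * y) ⟨by fun_prop, by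
          rw [Real.map_volume_mul_left hs]
          exact Measure.smul_absolutelyContinuous⟩
    filter_upwards [hqm.ae (ae_le_eLpNormEssSup (f := h) (μ := volume))] with y hy
    gcongr
  · set q := p.toReal
    have hq : 1 ≤ q := by
      simpa using ENNReal.toReal_mono hp' hp
    have hq0 : 0 < q := by linarith
    have hp0 : p ≠ 0 := by positivity
    rw [eLpNorm_eq_lintegral_rpow_enorm_toReal hp0 hp',
      eLpNorm_eq_lintegral_rpow_enorm_toReal hp0 hp']
    change (∫⁻ x, _ ^ q) ^ (1 / q) ≤ _ * (∫⁻ x, _ ^ q) ^ (1 / q)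
    have key : ∫⁻ x, ‖∫ y, K y * h (x - s * y)‖ₑ ^ q
        ≤ (∫⁻ y, ‖K y‖ₑ) ^ q * ∫⁻ x, ‖h x‖ₑ ^ q := by
      calc ∫⁻ x, ‖∫ y, K y * h (x - s * y)‖ₑ ^ q
          ≤ ∫⁻ x, (∫⁻ y, ‖K y‖ₑ * ‖h (x - s * y)‖ₑ ^ q) * (∫⁻ y, ‖K y‖ₑ) ^ (q - 1) := by
            refine lintegral_mono fun x ↦ ?_
            refine (ENNReal.rpow_le_rpow (hpt x) hq0.le).trans ?_
            exact lintegral_rpow_le_of_one_le (h := fun y ↦ h (x - s * y)) (by fun_prop)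
              (by fun_prop) hq
        _ = (∫⁻ y, ∫⁻ x, ‖K y‖ₑ * ‖h (x - s * y)‖ₑ ^ q) * (∫⁻ y, ‖K y‖ₑ) ^ (q - 1) := by
            have hm : Measurable fun z : ℝ × ℝ ↦ ‖K z.2‖ₑ * ‖h (z.1 - s * z.2)‖ₑ ^ q := by
              fun_prop
            rw [lintegral_mul_const _ hm.lintegral_prod_right', lintegral_lintegral_swap]
            exact hm.aemeasurable
        _ = (∫⁻ y, ‖K y‖ₑ) * (∫⁻ x, ‖h x‖ₑ ^ q) * (∫⁻ y, ‖K y‖ₑ) ^ (q - 1) := by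
            rw [← lintegral_mul_const (∫⁻ x, ‖h x‖ₑ ^ q) (by fun_prop : Measurable fun y ↦ ‖K y‖ₑ)]
            congr 1
            refine lintegral_congr fun y ↦ ?_
            rw [lintegral_const_mul _ (by fun_prop),
              lintegral_sub_right_eq_self (fun x ↦ ‖h x‖ₑ ^ q)]
        _ = (∫⁻ y, ‖K y‖ₑ) ^ q * ∫⁻ x, ‖h x‖ₑ ^ q := by
            conv_rhs => rw [show q = 1 + (q - 1) by ring,
              ENNReal.rpow_add_of_nonneg _ _ zero_le_one (by linarith), ENNReal.rpow_one]
            rw [add_sub_cancel]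
            ring
    refine (ENNReal.rpow_le_rpow key (by positivity)).trans ?_
    rw [ENNReal.mul_rpow_of_nonneg _ _ (by positivity), ← ENNReal.rpow_mul,
      mul_one_div_cancel hq0.ne', ENNReal.rpow_one]

theorem fourierInv_mul_eq_integral {K g G : ℝ → ℂ} (hK : Integrable K) (hKg : 𝓕 K = g)
    (hG : Integrable G) (s : ℝ) :
    𝓕⁻ (fun ξ ↦ g (s * ξ) * G ξ) = fun x ↦ ∫ y, K y * 𝓕⁻ G (x - s * y) := by
  ext x
  have hF : Integrable (fun z : ℝ × ℝ ↦ K z.1 * (𝐞 ((x - s * z.1) * z.2) • G z.2))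
      (volume.prod volume) := by
    have hc : Continuous fun z : ℝ × ℝ ↦ 𝐞 ((x - s * z.1) * z.2) :=
      Real.continuous_fourierChar.comp (by fun_prop)
    refine (hK.mul_prod hG).mono ?_ ?_
    · exact hK.1.comp_fst.mul (hc.aestronglyMeasurable.smul hG.1.comp_snd)
    · refine Filter.Eventually.of_forall fun z ↦ ?_
      simp [Circle.smul_def, Circle.norm_coe]
  simp only [Real.fourierInv_eq, ← integral_const_mul, RCLike.inner_apply, conj_trivial]
  have hsw := integral_integral_swap (f := fun y ξ ↦ K y * (𝐞 ((x - s * y) * ξ) • G ξ)) hF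
  trans ∫ ξ, ∫ y, K y * (𝐞 ((x - s * y) * ξ) • G ξ)
  · congr 1 with ξ
    rw [← hKg, Real.fourier_real_eq, ← integral_mul_const, Circle.smul_def, smul_eq_mul,
      ← integral_const_mul]
    congr 1 with y
    rw [show (x - s * y) * ξ = x * ξ + -(y * (s * ξ)) by ring, AddChar.map_add_eq_mul]
    simp only [Circle.smul_def, Circle.coe_mul, smul_eq_mul]
    ring
  · rw [← hsw]

theorem norm_fourierInv_le {g g₁ g₂ : ℝ → ℂ} {M R : ℝ} (hg : ∀ x, HasDerivAt g (g₁ x) x)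
    (hg₁ : ∀ x, HasDerivAt g₁ (g₂ x) x) (hR : 0 ≤ R) (h0 : ∀ x, ‖g x‖ ≤ M)
    (h2 : ∀ x, ‖g₂ x‖ ≤ M) (hs : ∀ x, R < |x| → g x = 0) (x : ℝ) :
    ‖𝓕⁻ g x‖ ≤ 4 * R * M * (1 + x ^ 2)⁻¹ := by
  have hM : 0 ≤ M := (norm_nonneg _).trans (h0 0)
  have hd : deriv g = g₁ := funext fun x ↦ (hg x).deriv
  have hd₁ : deriv g₁ = g₂ := funext fun x ↦ (hg₁ x).deriv
  have hev {x : ℝ} (hx : R < |x|) : g =ᶠ[nhds x] 0 := by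
    filter_upwards [continuous_abs.continuousAt.eventually (lt_mem_nhds hx)] with y hy using hs y hy
  have hs₁ (x : ℝ) (hx : R < |x|) : g₁ x = 0 := by
    rw [← hd, (hev hx).deriv_eq]; simp
  have hev₁ {x : ℝ} (hx : R < |x|) : g₁ =ᶠ[nhds x] 0 := by
    filter_upwards [continuous_abs.continuousAt.eventually (lt_mem_nhds hx)] with y hy using hs₁ y hy
  have hs₂ (x : ℝ) (hx : R < |x|) : g₂ x = 0 := by
    rw [← hd₁, (hev₁ hx).deriv_eq]; simp
  have hz {u : ℝ → ℂ} (hu : ∀ x, R < |x| → u x = 0) (x : ℝ) (hx : x ∉ Set.Icc (-R) R) :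
      u x = 0 := by
    refine hu x ?_
    contrapose! hx
    exact abs_le.1 hx
  have hcs {u : ℝ → ℂ} (hu : ∀ x, R < |x| → u x = 0) : HasCompactSupport u :=
    HasCompactSupport.intro isCompact_Icc (hz hu)
  have hcg : Continuous g := continuous_iff_continuousAt.2 fun x ↦ (hg x).continuousAt
  have hcg₁ : Continuous g₁ := continuous_iff_continuousAt.2 fun x ↦ (hg₁ x).continuousAt
  have hi : Integrable g := hcg.integrable_of_hasCompactSupport (hcs hs)
  have hi₁ : Integrable g₁ := hcg₁.integrable_of_hasCompactSupport (hcs hs₁)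
  have hi₂ : Integrable g₂ := by
    have hz₂ : g₂ = Set.indicator (Set.Icc (-R) R) g₂ :=
      (Set.indicator_eq_self.2 fun x hx ↦ by_contra fun h ↦ hx (hz hs₂ x h)).symm
    rw [hz₂, integrable_indicator_iff measurableSet_Icc]
    refine Measure.integrableOn_of_bounded (M := M) measure_Icc_lt_top.ne ?_
      (Filter.Eventually.of_forall h2)
    exact (hd₁ ▸ measurable_deriv g₁).aestronglyMeasurable
  have hL {u : ℝ → ℂ} (hu : ∀ x, R < |x| → u x = 0) (hb : ∀ x, ‖u x‖ ≤ M) (w : ℝ) :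
      ‖𝓕 u w‖ ≤ 2 * R * M := by
    have e : 𝓕 u w = ∫ v in Set.Icc (-R) R, 𝐞 (-(v * w)) • u v := by
      rw [Real.fourier_real_eq, setIntegral_eq_integral_of_forall_compl_eq_zero]
      intro v hv
      rw [hz hu v hv, smul_zero]
    have hb' : ∀ v ∈ Set.Icc (-R) R, ‖𝐞 (-(v * w)) • u v‖ ≤ M := fun v _ ↦ by
      simpa [Circle.smul_def, Circle.norm_coe] using hb v
    have := norm_setIntegral_le_of_norm_le_const (μ := volume) measure_Icc_lt_top hb'
    rw [e]
    refine this.trans (le_of_eq ?_)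
    simp only [measureReal_def, Real.volume_Icc]
    rw [ENNReal.toReal_ofReal (by linarith)]
    ring
  have hF2 : 𝓕 g₂ (-x) = (2 * π * I * (-x : ℝ)) * ((2 * π * I * (-x : ℝ)) * 𝓕 g (-x)) := by
    have e1 := congrFun (Real.fourier_deriv hi (fun x ↦ (hg x).differentiableAt) (hd ▸ hi₁)) (-x)
    have e2 := congrFun (Real.fourier_deriv hi₁ (fun x ↦ (hg₁ x).differentiableAt) (hd₁ ▸ hi₂)) (-x)
    rw [hd] at e1
    rw [hd₁] at e2
    rw [e2, e1]; simp
  have b0 := hL hs h0 (-x)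
  have b2 := hL hs₂ h2 (-x)
  rw [hF2] at b2
  rw [Real.fourierInv_eq_fourier_neg]
  have hn : ‖(2 * π * I * (-x : ℝ) : ℂ)‖ = 2 * π * |x| := by
    simp [abs_of_pos pi_pos]
  rw [norm_mul _ (_ * _), norm_mul _ (𝓕 g (-x)), hn] at b2
  have hp : (1 : ℝ) ≤ (2 * π) ^ 2 := by nlinarith [pi_gt_three]
  rw [← div_eq_mul_inv, le_div_iff₀ (by positivity)]
  have e : 2 * π * |x| * (2 * π * |x| * ‖𝓕 g (-x)‖) = (2 * π) ^ 2 * (x ^ 2 * ‖𝓕 g (-x)‖) := by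
    rw [← sq_abs x]; ring
  have : x ^ 2 * ‖𝓕 g (-x)‖ ≤ (2 * π) ^ 2 * (x ^ 2 * ‖𝓕 g (-x)‖) :=
    le_mul_of_one_le_left (by positivity) hp
  linarith

theorem continuous_fourierInv_of_integrable {u : ℝ → ℂ} (hu : Integrable u) :
    Continuous (𝓕⁻ u) := by
  have h : Continuous (𝓕 u) := VectorFourier.fourierIntegral_continuous
    Real.continuous_fourierChar (L := innerₗ ℝ) (by exact continuous_inner) hu
  have e : 𝓕⁻ u = fun x ↦ 𝓕 u (-x) := funext fun x ↦ Real.fourierInv_eq_fourier_neg u x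
  rw [e]
  exact h.comp continuous_neg

theorem eLpNorm_fourierInv_mul_le_s2 {g g₁ g₂ G : ℝ → ℂ} {M R : ℝ}
    (hg : ∀ x, HasDerivAt g (g₁ x) x) (hg₁ : ∀ x, HasDerivAt g₁ (g₂ x) x) (hR : 0 ≤ R)
    (h0 : ∀ x, ‖g x‖ ≤ M) (h2 : ∀ x, ‖g₂ x‖ ≤ M) (hs : ∀ x, R < |x| → g x = 0)
    (hG : Integrable G) {s : ℝ} (hs0 : s ≠ 0) {p : ℝ≥0∞} (hp : 1 ≤ p) :
    eLpNorm (𝓕⁻ (fun ξ ↦ g (s * ξ) * G ξ)) p volume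
      ≤ ENNReal.ofReal (4 * R * M * π) * eLpNorm (𝓕⁻ G) p volume := by
  have hcg : Continuous g := continuous_iff_continuousAt.2 fun x ↦ (hg x).continuousAt
  have hi : Integrable g := by
    refine hcg.integrable_of_hasCompactSupport
      (HasCompactSupport.intro (isCompact_Icc (a := -R) (b := R)) fun x hx ↦ hs x ?_)
    contrapose! hx
    exact abs_le.1 hx
  have hcK := continuous_fourierInv_of_integrable hi
  have hbd := norm_fourierInv_le hg hg₁ hR h0 h2 hs
  have hint : Integrable fun x : ℝ ↦ 4 * R * M * (1 + x ^ 2)⁻¹ :=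
    integrable_inv_one_add_sq.const_mul _
  have hK : Integrable (𝓕⁻ g) :=
    hint.mono' hcK.aestronglyMeasurable (Filter.Eventually.of_forall hbd)
  have hKg : 𝓕 (𝓕⁻ g) = g := by
    refine hcg.fourier_fourierInv_eq hi ?_
    have e : 𝓕 g = fun x ↦ 𝓕⁻ g (-x) := by
      ext x
      rw [Real.fourierInv_eq_fourier_neg, neg_neg]
    rw [e]
    exact hK.comp_neg
  rw [fourierInv_mul_eq_integral hK hKg hG s]
  refine (eLpNorm_integral_mul_comp_sub_le hcK.measurable
    (continuous_fourierInv_of_integrable hG).measurable hs0 hp).trans ?_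
  gcongr
  rw [← ofReal_integral_norm_eq_lintegral_enorm hK]
  refine ENNReal.ofReal_le_ofReal ?_
  refine (integral_mono hK.norm hint hbd).trans (le_of_eq ?_)
  rw [integral_const_mul, integral_univ_inv_one_add_sq]

theorem lamM_eq_neg_lamP (α ξ : ℝ) : lamM α ξ = -lamP (-α) ξ := by
  simp only [lamM, lamP, neg_sq]; ring

theorem lamP_nonneg (α ξ : ℝ) : 0 ≤ lamP α ξ := by
  have : |α| ≤ √(α ^ 2 + 4 * ξ ^ 2) := Real.abs_le_sqrt (by nlinarith [sq_nonneg ξ])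
  have := neg_abs_le α
  unfold lamP; linarith

theorem lamP_le_lamP {α ξ η : ℝ} (h : ξ ^ 2 ≤ η ^ 2) : lamP α ξ ≤ lamP α η := by
  unfold lamP; gcongr

theorem lamP_mul_s2 {s : ℝ} (hs : 0 ≤ s) (α ξ : ℝ) : lamP (s * α) (s * ξ) = s * lamP α ξ := by
  unfold lamP
  rw [show (s * α) ^ 2 + 4 * (s * ξ) ^ 2 = s ^ 2 * (α ^ 2 + 4 * ξ ^ 2) by ring,
    Real.sqrt_mul (sq_nonneg s), Real.sqrt_sq hs]
  ring

/-- The discriminant root is comparable with `ξ ^ 2 / λ₊`. -/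
theorem sq_le_lamP_mul_sqrt (α ξ : ℝ) : ξ ^ 2 ≤ lamP α ξ * √(α ^ 2 + 4 * ξ ^ 2) := by
  have h := Real.sq_sqrt (by positivity : 0 ≤ α ^ 2 + 4 * ξ ^ 2)
  have h1 : |α| ≤ √(α ^ 2 + 4 * ξ ^ 2) := Real.abs_le_sqrt (by nlinarith [sq_nonneg ξ])
  have h2 := neg_abs_le α
  have h3 := le_abs_self α
  unfold lamP
  nlinarith [Real.sqrt_nonneg (α ^ 2 + 4 * ξ ^ 2)]

theorem hasDerivAt_lamP_s2 (α : ℝ) {ξ : ℝ} (hξ : ξ ≠ 0) :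
    HasDerivAt (lamP α) (2 * ξ / √(α ^ 2 + 4 * ξ ^ 2)) ξ := by
  have h0 : α ^ 2 + 4 * ξ ^ 2 ≠ 0 := by positivity
  have h := ((((hasDerivAt_pow 2 ξ).const_mul 4).const_add (α ^ 2)).sqrt h0).const_add α
    |>.div_const 2
  convert! h using 1
  field_simp
  ring

theorem hasDerivAt_deriv_lamP_s2 (α : ℝ) {ξ : ℝ} (hξ : ξ ≠ 0) :
    HasDerivAt (fun ξ ↦ 2 * ξ / √(α ^ 2 + 4 * ξ ^ 2)) (2 * α ^ 2 / √(α ^ 2 + 4 * ξ ^ 2) ^ 3) ξ := by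
  have h0 : 0 < α ^ 2 + 4 * ξ ^ 2 := by positivity
  have hs := Real.sqrt_pos.2 h0
  have h := ((hasDerivAt_id ξ).const_mul 2).div
    ((((hasDerivAt_pow 2 ξ).const_mul 4).const_add (α ^ 2)).sqrt h0.ne') hs.ne'
  convert! h using 1
  have := Real.sq_sqrt h0.le
  set S := √(α ^ 2 + 4 * ξ ^ 2)
  simp only [id_eq]
  field_simp
  rw [this]
  push_cast
  ring

theorem abs_deriv_lamP_le (α : ℝ) {ξ : ℝ} (hξ : 1 ≤ |ξ|) :
    |2 * ξ / √(α ^ 2 + 4 * ξ ^ 2)| ≤ 2 * lamP α ξ := by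
  have hξ0 : ξ ≠ 0 := by rintro rfl; norm_num at hξ
  have hs : 0 < √(α ^ 2 + 4 * ξ ^ 2) := Real.sqrt_pos.2 (by positivity)
  rw [abs_div, abs_mul, abs_of_pos hs, div_le_iff₀ hs, abs_two]
  nlinarith [sq_le_lamP_mul_sqrt α ξ, sq_abs ξ]

theorem abs_deriv_deriv_lamP_le (α : ℝ) {ξ : ℝ} (hξ : 1 ≤ |ξ|) :
    |2 * α ^ 2 / √(α ^ 2 + 4 * ξ ^ 2) ^ 3| ≤ 2 * lamP α ξ := by
  have hξ0 : ξ ≠ 0 := by rintro rfl; norm_num at hξ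
  have h0 : 0 < α ^ 2 + 4 * ξ ^ 2 := by positivity
  have hs : 0 < √(α ^ 2 + 4 * ξ ^ 2) := Real.sqrt_pos.2 h0
  rw [abs_of_nonneg (by positivity), div_le_iff₀ (by positivity)]
  have h1 := Real.sq_sqrt h0.le
  have h2 := sq_le_lamP_mul_sqrt α ξ
  have h3 : 1 ≤ ξ ^ 2 := by rw [← sq_abs]; nlinarith
  calc 2 * α ^ 2 ≤ 2 * (1 * √(α ^ 2 + 4 * ξ ^ 2) ^ 2) := by rw [h1]; linarith
    _ ≤ 2 * (lamP α ξ * √(α ^ 2 + 4 * ξ ^ 2) * √(α ^ 2 + 4 * ξ ^ 2) ^ 2) := by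
        gcongr; linarith
    _ = _ := by ring

theorem mul_exp_neg_le (u : ℝ) : u * rexp (-u) ≤ 2 * rexp (-(u / 2)) := by
  have h : u ≤ 2 * rexp (u / 2) := by linarith [Real.add_one_le_exp (u / 2)]
  calc u * rexp (-u) ≤ 2 * rexp (u / 2) * rexp (-u) := by gcongr
    _ = _ := by rw [mul_assoc, ← Real.exp_add]; ring_nf

theorem sq_mul_exp_neg_le {u : ℝ} (hu : 0 ≤ u) : u ^ 2 * rexp (-u) ≤ 8 * rexp (-(u / 2)) := by
  have h : u ^ 2 ≤ 8 * rexp (u / 2) := by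
    linarith [Real.quadratic_le_exp_of_nonneg (x := u / 2) (by positivity)]
  calc u ^ 2 * rexp (-u) ≤ 8 * rexp (u / 2) * rexp (-u) := by gcongr
    _ = _ := by rw [mul_assoc, ← Real.exp_add]; ring_nf

/-- First derivative of `ξ ↦ exp (-t λ₊(a, 2πξ))`. -/
def expLam₁ (a t ξ : ℝ) : ℝ :=
  -(t * (2 * π * (2 * (2 * π * ξ) / √(a ^ 2 + 4 * (2 * π * ξ) ^ 2)))) *
    rexp (-(t * lamP a (2 * π * ξ)))

/-- Second derivative of `ξ ↦ exp (-t λ₊(a, 2πξ))`. -/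
def expLam₂ (a t ξ : ℝ) : ℝ :=
  ((t * (2 * π * (2 * (2 * π * ξ) / √(a ^ 2 + 4 * (2 * π * ξ) ^ 2)))) ^ 2 -
      t * ((2 * π) ^ 2 * (2 * a ^ 2 / √(a ^ 2 + 4 * (2 * π * ξ) ^ 2) ^ 3))) *
    rexp (-(t * lamP a (2 * π * ξ)))

theorem hasDerivAt_expLam (a t : ℝ) {ξ : ℝ} (hξ : ξ ≠ 0) :
    HasDerivAt (fun ξ ↦ rexp (-(t * lamP a (2 * π * ξ)))) (expLam₁ a t ξ) ξ := by
  have hξ' : 2 * π * ξ ≠ 0 := by positivity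
  have hl : HasDerivAt (fun ξ ↦ 2 * π * ξ) (2 * π) ξ := by
    simpa using (hasDerivAt_id ξ).const_mul (2 * π)
  have h := (((hasDerivAt_lamP_s2 a hξ').comp ξ hl).const_mul t).neg.exp
  convert! h using 1
  simp only [expLam₁, Function.comp, Pi.neg_apply]
  ring

theorem hasDerivAt_expLam₁ (a t : ℝ) {ξ : ℝ} (hξ : ξ ≠ 0) :
    HasDerivAt (expLam₁ a t) (expLam₂ a t ξ) ξ := by
  have hξ' : 2 * π * ξ ≠ 0 := by positivity
  have hl : HasDerivAt (fun ξ ↦ 2 * π * ξ) (2 * π) ξ := by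
    simpa using (hasDerivAt_id ξ).const_mul (2 * π)
  have h := ((((hasDerivAt_deriv_lamP_s2 a hξ').comp ξ hl).const_mul (2 * π)).const_mul t).neg.mul
    (hasDerivAt_expLam a t hξ)
  convert! h using 1
  simp only [expLam₂, expLam₁, Function.comp, Pi.neg_apply]
  ring

theorem abs_expLam_bounds {a t ξ : ℝ} (ht : 0 ≤ t) (hξ : 1 / 4 ≤ |ξ|) :
    rexp (-(t * lamP a (2 * π * ξ))) ≤ rexp (-(t * lamP a 1 / 2)) ∧
    |expLam₁ a t ξ| ≤ 8 * π * rexp (-(t * lamP a 1 / 2)) ∧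
    |expLam₂ a t ξ| ≤ 144 * π ^ 2 * rexp (-(t * lamP a 1 / 2)) := by
  have hη : 1 ≤ |2 * π * ξ| := by
    rw [abs_mul, abs_of_pos (by positivity)]
    nlinarith [pi_gt_three]
  have hη2 : (1 : ℝ) ^ 2 ≤ (2 * π * ξ) ^ 2 := by rw [← sq_abs (2 * π * ξ)]; gcongr
  have b1 := abs_deriv_lamP_le a hη
  have b2 := abs_deriv_deriv_lamP_le a hη
  have hl := lamP_nonneg a (2 * π * ξ)
  have hm : t * lamP a 1 ≤ t * lamP a (2 * π * ξ) := by
    gcongr; exact lamP_le_lamP hη2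
  have hu : 0 ≤ t * lamP a (2 * π * ξ) := by positivity
  have e : rexp (-(t * lamP a (2 * π * ξ) / 2)) ≤ rexp (-(t * lamP a 1 / 2)) := by
    gcongr
  unfold expLam₁ expLam₂
  set L := lamP a (2 * π * ξ)
  set D := 2 * (2 * π * ξ) / √(a ^ 2 + 4 * (2 * π * ξ) ^ 2)
  set D₂ := 2 * a ^ 2 / √(a ^ 2 + 4 * (2 * π * ξ) ^ 2) ^ 3
  have k1 := (mul_exp_neg_le (t * L))
  have k2 := (sq_mul_exp_neg_le hu)
  have hD : |t * (2 * π * D)| ≤ 4 * π * (t * L) := by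
    rw [abs_mul, abs_mul, abs_of_nonneg ht, abs_of_pos (by positivity : 0 < 2 * π)]
    calc t * (2 * π * |D|) ≤ t * (2 * π * (2 * L)) := by gcongr
      _ = _ := by ring
  have hD₂ : |t * ((2 * π) ^ 2 * D₂)| ≤ 8 * π ^ 2 * (t * L) := by
    rw [abs_mul, abs_mul, abs_of_nonneg ht, abs_of_pos (by positivity : 0 < (2 * π) ^ 2)]
    calc t * ((2 * π) ^ 2 * |D₂|) ≤ t * ((2 * π) ^ 2 * (2 * L)) := by gcongr
      _ = _ := by ring
  refine ⟨(Real.exp_le_exp.2 (by linarith)).trans e, ?_, ?_⟩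
  · rw [abs_mul, abs_neg, abs_of_pos (Real.exp_pos _)]
    calc _ ≤ 4 * π * (t * L) * rexp (-(t * L)) := by gcongr
      _ = 4 * π * (t * L * rexp (-(t * L))) := by ring
      _ ≤ 4 * π * (2 * rexp (-(t * L / 2))) := by gcongr
      _ ≤ 4 * π * (2 * rexp (-(t * lamP a 1 / 2))) := by gcongr
      _ = _ := by ring
  · rw [abs_mul, abs_of_pos (Real.exp_pos _)]
    calc _ ≤ ((4 * π * (t * L)) ^ 2 + 8 * π ^ 2 * (t * L)) * rexp (-(t * L)) := by
          gcongr
          refine (abs_sub _ _).trans ?_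
          rw [abs_pow]
          gcongr
      _ = 16 * π ^ 2 * ((t * L) ^ 2 * rexp (-(t * L))) +
            8 * π ^ 2 * (t * L * rexp (-(t * L))) := by ring
      _ ≤ 16 * π ^ 2 * (8 * rexp (-(t * L / 2))) + 8 * π ^ 2 * (2 * rexp (-(t * L / 2))) := by
          gcongr
      _ = 144 * π ^ 2 * rexp (-(t * L / 2)) := by ring
      _ ≤ _ := by gcongr

/-- A twice differentiable cutoff to an annulus, equal to one on `1/2 ≤ |ξ| ≤ 2`. -/
theorem exists_annulus_cutoff_s2 : ∃ (χ χ₁ χ₂ : ℝ → ℝ) (B : ℝ),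
    (∀ x, HasDerivAt χ (χ₁ x) x) ∧ (∀ x, HasDerivAt χ₁ (χ₂ x) x) ∧
    (∀ x, |χ x| ≤ B) ∧ (∀ x, |χ₁ x| ≤ B) ∧ (∀ x, |χ₂ x| ≤ B) ∧
    (∀ x, |x| < 1 / 4 ∨ 3 < |x| → χ x = 0) ∧ (∀ x, |x| < 1 / 4 ∨ 3 < |x| → χ₁ x = 0) ∧
    (∀ x, |x| < 1 / 4 ∨ 3 < |x| → χ₂ x = 0) ∧ (∀ x, 1 / 2 ≤ |x| → |x| ≤ 2 → χ x = 1) := by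
  let b : ContDiffBump (17 / 8 : ℝ) := ⟨15 / 8, 2, by norm_num, by norm_num⟩
  let χ : ℝ → ℝ := fun x ↦ b (x ^ 2)
  have hχ : ContDiff ℝ 2 χ := b.contDiff.comp (contDiff_id.pow 2)
  have hχ₁ : ContDiff ℝ 1 (deriv χ) := (contDiff_succ_iff_deriv (n := 1).1 hχ).2.2
  have hχ₂ : Continuous (deriv (deriv χ)) := hχ₁.continuous_deriv le_rfl
  have ho : IsOpen {x : ℝ | |x| < 1 / 4 ∨ 3 < |x|} :=
    (isOpen_lt continuous_abs continuous_const).union (isOpen_lt continuous_const continuous_abs)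
  have hz : ∀ x, |x| < 1 / 4 ∨ 3 < |x| → χ x = 0 := by
    intro x hx
    refine b.zero_of_le_dist ?_
    change 2 ≤ _
    rw [Real.dist_eq, ← sq_abs x, le_abs]
    rcases hx with hx | hx
    · right; nlinarith [abs_nonneg x]
    · left; nlinarith
  have hderiv {u : ℝ → ℝ} (hu : ∀ x, |x| < 1 / 4 ∨ 3 < |x| → u x = 0) :
      ∀ x, |x| < 1 / 4 ∨ 3 < |x| → deriv u x = 0 := by
    intro x hx
    have : u =ᶠ[nhds x] 0 := by
      filter_upwards [ho.mem_nhds hx] with y hy using hu y hy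
    rw [this.deriv_eq]; simp
  have hcs {u : ℝ → ℝ} (hu : ∀ x, |x| < 1 / 4 ∨ 3 < |x| → u x = 0) : HasCompactSupport u :=
    HasCompactSupport.intro (isCompact_Icc (a := -3) (b := 3)) fun x hx ↦ hu x (Or.inr (by
      contrapose! hx
      exact abs_le.1 hx))
  have hz₁ := hderiv hz
  have hz₂ := hderiv hz₁
  obtain ⟨B₀, hB₀⟩ := (hcs hz).exists_bound_of_continuous hχ.continuous
  obtain ⟨B₁, hB₁⟩ := (hcs hz₁).exists_bound_of_continuous hχ₁.continuous
  obtain ⟨B₂, hB₂⟩ := (hcs hz₂).exists_bound_of_continuous hχ₂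
  refine ⟨χ, deriv χ, deriv (deriv χ), max B₀ (max B₁ B₂),
    fun x ↦ (hχ.differentiable (by norm_num) x).hasDerivAt,
    fun x ↦ (hχ₁.differentiable (by norm_num) x).hasDerivAt,
    fun x ↦ (hB₀ x).trans (le_max_left _ _),
    fun x ↦ (hB₁ x).trans ((le_max_left _ _).trans (le_max_right _ _)),
    fun x ↦ (hB₂ x).trans ((le_max_right _ _).trans (le_max_right _ _)), hz, hz₁, hz₂, ?_⟩
  intro x hx hx'
  refine b.one_of_mem_closedBall ?_
  change dist _ _ ≤ 15 / 8
  rw [Real.dist_eq, ← sq_abs x, abs_le]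
  constructor <;> nlinarith

theorem hasDerivAt_mul_expLam {χ χ₁ F F₁ : ℝ → ℝ} (hχ : ∀ x, HasDerivAt χ (χ₁ x) x)
    (hF : ∀ x, x ≠ 0 → HasDerivAt F (F₁ x) x) (hz : ∀ x, |x| < 1 / 4 → χ x = 0)
    (hz₁ : ∀ x, |x| < 1 / 4 → χ₁ x = 0) (x : ℝ) :
    HasDerivAt (fun x ↦ χ x * F x) (χ₁ x * F x + χ x * F₁ x) x := by
  rcases eq_or_ne x 0 with rfl | hx
  · rw [hz 0 (by norm_num), hz₁ 0 (by norm_num)]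
    have h : (fun x ↦ χ x * F x) =ᶠ[nhds 0] fun _ ↦ 0 := by
      filter_upwards [Metric.ball_mem_nhds (0 : ℝ) (by norm_num : (0 : ℝ) < 1 / 4)] with y hy
      rw [hz y (by simpa using hy), zero_mul]
    simpa using (hasDerivAt_const (0 : ℝ) (0 : ℝ)).congr_of_eventuallyEq h
  · exact (hχ x).mul (hF x hx)

/-- Frequency-localized bound for the multiplier `e^{-t λ₊(a, 2πξ)}`, uniform in `a`, `t` and the
dilation `s`. -/
theorem exists_eLpNorm_fourierInv_exp_lamP_le : ∃ C : ℝ, 0 < C ∧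
    ∀ (a t s : ℝ), 0 ≤ t → s ≠ 0 → ∀ p : ℝ≥0∞, 1 ≤ p → ∀ G : ℝ → ℂ, Integrable G →
      (∀ ξ, G ξ ≠ 0 → 1 / 2 ≤ |s * ξ| ∧ |s * ξ| ≤ 2) →
      eLpNorm (𝓕⁻ (fun ξ : ℝ ↦ (rexp (-(t * lamP a (2 * π * (s * ξ)))) : ℂ) * G ξ)) p volume
        ≤ ENNReal.ofReal (C * rexp (-(t * lamP a 1 / 2))) * eLpNorm (𝓕⁻ G) p volume := by
  obtain ⟨χ, χ₁, χ₂, B, hχ, hχ₁, hB, hB₁, hB₂, hz, hz₁, hz₂, hone⟩ := exists_annulus_cutoff_s2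
  have hB1 : 1 ≤ B := by
    simpa [hone 1 (by norm_num) (by norm_num)] using hB 1
  have hB0 : 0 ≤ B := by linarith
  refine ⟨4 * 3 * (B * (1 + 16 * π + 144 * π ^ 2)) * π, by positivity, ?_⟩
  intro a t s ht hs p hp G hG hsupp
  set E := fun ξ ↦ rexp (-(t * lamP a (2 * π * ξ))) with hE
  set X := rexp (-(t * lamP a 1 / 2))
  have hX : 0 < X := Real.exp_pos _
  have hd := hasDerivAt_mul_expLam hχ (fun x hx ↦ hasDerivAt_expLam a t hx)
    (fun x hx ↦ hz x (.inl hx)) (fun x hx ↦ hz₁ x (.inl hx))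
  have hd₁ (x : ℝ) := (hasDerivAt_mul_expLam hχ₁ (fun x hx ↦ hasDerivAt_expLam a t hx)
    (fun x hx ↦ hz₁ x (.inl hx)) (fun x hx ↦ hz₂ x (.inl hx)) x).add
    (hasDerivAt_mul_expLam hχ (fun x hx ↦ hasDerivAt_expLam₁ a t hx)
    (fun x hx ↦ hz x (.inl hx)) (fun x hx ↦ hz₁ x (.inl hx)) x)
  have key := eLpNorm_fourierInv_mul_le_s2 (R := 3) (M := B * (1 + 16 * π + 144 * π ^ 2) * X)
    (fun x ↦ (hd x).ofReal_comp) (fun x ↦ (hd₁ x).ofReal_comp) (by norm_num) ?_ ?_ ?_ hG hs hp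
  · convert key using 2
    · congr 1
      ext ξ
      by_cases hGξ : G ξ = 0
      · simp [hGξ]
      · obtain ⟨h1, h2⟩ := hsupp ξ hGξ
        simp [hone _ h1 h2]
    · congr 1
      ring
  · intro x
    rw [Complex.norm_real, Real.norm_eq_abs]
    rcases lt_or_ge |x| (1 / 4) with hx | hx
    · rw [hz x (.inl hx), zero_mul, abs_zero]; positivity
    · have b0 := (abs_expLam_bounds (a := a) ht hx).1
      rw [abs_mul, abs_of_pos (Real.exp_pos _)]
      calc _ ≤ B * X := by gcongr; exact hB x
        _ ≤ B * (1 + 16 * π + 144 * π ^ 2) * X := by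
          gcongr
          refine le_mul_of_one_le_right hB0 ?_
          have : 0 < 16 * π + 144 * π ^ 2 := by positivity
          linarith
  · intro x
    rw [Complex.norm_real, Real.norm_eq_abs]
    rcases lt_or_ge |x| (1 / 4) with hx | hx
    · simp only [hz x (.inl hx), hz₁ x (.inl hx), hz₂ x (.inl hx), zero_mul, add_zero, abs_zero]
      positivity
    · obtain ⟨b0, b1, b2⟩ := abs_expLam_bounds (a := a) ht hx
      refine (abs_add_le _ _).trans ((add_le_add (abs_add_le _ _) (abs_add_le _ _)).trans ?_)
      simp only [abs_mul, abs_of_pos (Real.exp_pos _)]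
      calc _ ≤ B * X + B * (8 * π * X) + (B * (8 * π * X) + B * (144 * π ^ 2 * X)) := by
            gcongr <;> first | exact hB x | exact hB₁ x | exact hB₂ x
        _ = _ := by ring
  · intro x hx
    simp [hz x (.inr hx)]

/-- frequency-localized bounds for the semigroup multipliers
`e^{−λ₊(α,2πξ)T}` and `e^{λ₋(α,2πξ)T}`:
`‖𝓕⁻¹[e^{∓λ±(α,2πξ)T} φ_j 𝓕f]‖_{L^p} ≤ C e^{∓c λ±(α,2^j)T} ‖Δ_j f‖_{L^p}`. -/
theorem statement2 (φ₀ : ℝ → ℝ)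
    (hφ_smooth : ContDiff ℝ (⊤ : ℕ∞) φ₀)
    (hφ_range : ∀ ξ : ℝ, 0 ≤ φ₀ ξ ∧ φ₀ ξ ≤ 1)
    (hφ_supp : Function.support φ₀ ⊆ {ξ : ℝ | 1/2 ≤ |ξ| ∧ |ξ| ≤ 2})
    (hφ_sum : ∀ ξ : ℝ, ξ ≠ 0 → HasSum (fun j : ℤ => φ₀ ((2:ℝ) ^ (-j) * ξ)) 1) :
    ∃ c C : ℝ, 0 < c ∧ 0 < C ∧
      ∀ (α : ℝ) (T : ℝ), 0 < T → ∀ (j : ℤ) (p : ℝ≥0∞), 1 ≤ p → ∀ f : 𝓢(ℝ, ℂ),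
        eLpNorm (𝓕⁻ (fun ξ : ℝ =>
            (Real.exp (-(lamP α (2 * π * ξ)) * T) : ℂ)
              * (φ₀ ((2:ℝ) ^ (-j) * ξ) : ℂ) * 𝓕 (⇑f) ξ)) p volume
          ≤ ENNReal.ofReal (C * Real.exp (-(c * lamP α ((2:ℝ) ^ j) * T))) *
            eLpNorm (𝓕⁻ (fun ξ : ℝ =>
              (φ₀ ((2:ℝ) ^ (-j) * ξ) : ℂ) * 𝓕 (⇑f) ξ)) p volume
        ∧
        eLpNorm (𝓕⁻ (fun ξ : ℝ =>
            (Real.exp (lamM α (2 * π * ξ) * T) : ℂ)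
              * (φ₀ ((2:ℝ) ^ (-j) * ξ) : ℂ) * 𝓕 (⇑f) ξ)) p volume
          ≤ ENNReal.ofReal (C * Real.exp (c * lamM α ((2:ℝ) ^ j) * T)) *
            eLpNorm (𝓕⁻ (fun ξ : ℝ =>
              (φ₀ ((2:ℝ) ^ (-j) * ξ) : ℂ) * 𝓕 (⇑f) ξ)) p volume := by
  obtain ⟨C, hC, h⟩ := exists_eLpNorm_fourierInv_exp_lamP_le
  have main (α T : ℝ) (hT : 0 < T) (j : ℤ) (p : ℝ≥0∞) (hp : 1 ≤ p) (f : 𝓢(ℝ, ℂ)) :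
      eLpNorm (𝓕⁻ (fun ξ : ℝ ↦ (Real.exp (-(lamP α (2 * π * ξ)) * T) : ℂ)
          * (φ₀ ((2:ℝ) ^ (-j) * ξ) : ℂ) * 𝓕 (⇑f) ξ)) p volume
        ≤ ENNReal.ofReal (C * Real.exp (-(1 / 2 * lamP α ((2:ℝ) ^ j) * T))) *
          eLpNorm (𝓕⁻ (fun ξ : ℝ ↦ (φ₀ ((2:ℝ) ^ (-j) * ξ) : ℂ) * 𝓕 (⇑f) ξ)) p volume := by
    have hs : 0 < (2 : ℝ) ^ (-j) := by positivity
    have hs' : 0 < (2 : ℝ) ^ j := by positivity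
    have hG : Integrable fun ξ : ℝ ↦ (φ₀ ((2:ℝ) ^ (-j) * ξ) : ℂ) * 𝓕 (⇑f) ξ := by
      have hf : Integrable (𝓕 (⇑f)) := by
        rw [← SchwartzMap.fourier_coe]; exact (𝓕 f).integrable
      have hc : Continuous φ₀ := hφ_smooth.continuous
      refine hf.bdd_mul (c := 1) (by fun_prop) (Filter.Eventually.of_forall fun ξ ↦ ?_)
      rw [Complex.norm_real, Real.norm_eq_abs, abs_of_nonneg (hφ_range _).1]
      exact (hφ_range _).2
    have key := h ((2 : ℝ) ^ (-j) * α) ((2 : ℝ) ^ j * T) ((2 : ℝ) ^ (-j)) (by positivity) hs.ne'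
      p hp _ hG fun ξ hξ ↦ hφ_supp fun h0 ↦ hξ (by rw [h0, Complex.ofReal_zero, zero_mul])
    have hmul : (2 : ℝ) ^ j * (2 : ℝ) ^ (-j) = 1 := by
      rw [zpow_neg, mul_inv_cancel₀ hs'.ne']
    have hscale (η : ℝ) :
        (2 : ℝ) ^ j * T * lamP ((2 : ℝ) ^ (-j) * α) η = lamP α ((2 : ℝ) ^ j * η) * T := by
      have := lamP_mul_s2 hs'.le ((2 : ℝ) ^ (-j) * α) η
      rw [← mul_assoc, hmul, one_mul] at this
      rw [this]; ring
    simp only [hscale, mul_one] at key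
    convert key using 4 with ξ
    · rw [show (2 : ℝ) ^ j * (2 * π * ((2 : ℝ) ^ (-j) * ξ))
        = 2 * π * ((2 : ℝ) ^ j * (2 : ℝ) ^ (-j) * ξ) by ring, hmul, one_mul, neg_mul, mul_assoc]
    · congr 1; ring
  refine ⟨1 / 2, C, by norm_num, hC, fun α T hT j p hp f ↦ ⟨main α T hT j p hp f, ?_⟩⟩
  have := main (-α) T hT j p hp f
  simpa only [lamM_eq_neg_lamP, mul_neg, neg_mul] using this
end
end
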